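/- Let p > 2 be a prime and let a, b, a', b' be nonzero elements of ℤ_p ⊆ ℚ_p with a ≠ b and a' ≠ b'. Assume ν_p(a) = 0 and ν_p(a−b) ≥ 1 (i.e., a ≡ b ≢ 0 (mod p), so the first curve does not have potential good reduction), while ν_p(a') = ν_p(b') = 0 and ν_p(a'−b') = 0 (so the second curve has potential good reduction), and assume every vector of 𝔽₂⁴ is a kernel vector of M_{aba'b'} (equivalently, all entries of M_{aba'b'} are squares in ℚ_p). Then on the set of points P = (x,u,z) ∈ ℚ_p³ with z ≠ 0 and z² = x(x−a)(x−b)·u(u−a')(u−b'): the maps ev_{e₁} and ev_{e₂} are identically 0, while each of ev_{e₃}, ev_{e₄} and ev_{e₃+e₄} is non-constant. (Hence the subspace of 2-torsion Brauer classes with constant evaluation map has dimension exactly 2.) -/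

import Mathlib

/-- The Hilbert symbol `(A,B)_k` is trivial if `A·r² + B·s² = 1` is solvable. -/
def HilbertTrivial {k : Type*} [Field k] (A B : k) : Prop :=
  ∃ r s : k, A * r ^ 2 + B * s ^ 2 = 1

/-- The Skorobogatov–Zarhin matrix `M_{aba'b'}`. -/
def SZMatrix {k : Type*} [Field k] (a b a' b' : k) : Fin 4 → Fin 4 → k :=
  ![![1, a * b, a' * b', -(a * a')],
    ![a * b, 1, a * a', a' * (a' - b')],
    ![a' * b', a * a', 1, a * (a - b)],
    ![-(a * a'), a' * (a' - b'), a * (a - b), 1]]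

/-- `ε ∈ 𝔽₂⁴` is a kernel vector of `M_{aba'b'}` if for every row `i` the product of
those entries `M i j` with `ε j = 1` is a square in `k`. -/
def IsKernelVector {k : Type*} [Field k] (a b a' b' : k) (ε : Fin 4 → ZMod 2) : Prop :=
  ∀ i : Fin 4,
    IsSquare (∏ j ∈ Finset.univ.filter (fun j : Fin 4 => ε j = 1), SZMatrix a b a' b' i j)

/-- The four pairs of rational functions defining the basis quaternion algebras,
evaluated at `(x, u)`. -/
def symPair {k : Type*} [Field k] (a b a' b' x u : k) : Fin 4 → k × k :=
  ![((x - a) * (x - b), (u - a') * (u - b')),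
    ((x - a) * (x - b), u * (u - b')),
    (x * (x - b), (u - a') * (u - b')),
    (x * (x - b), u * (u - b'))]

open Classical in
/-- The evaluation map `ev_ε` at the point with coordinates `(x, u)`:
the sum over those `i` with `ε i = 1` of `0` or `1` according to whether the
`i`-th Hilbert symbol is trivial or not. -/
noncomputable def evMap {k : Type*} [Field k] (a b a' b' : k) (ε : Fin 4 → ZMod 2)
    (x u : k) : ZMod 2 :=
  ∑ i ∈ Finset.univ.filter (fun i : Fin 4 => ε i = 1),
    (if HilbertTrivial (symPair a b a' b' x u i).1 (symPair a b a' b' x u i).2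
      then (0 : ZMod 2) else 1)

/-- The standard basis vectors of `𝔽₂⁴`. -/
def stdBasis (i : Fin 4) : Fin 4 → ZMod 2 := Pi.single i 1

section FiniteField

variable {F : Type*} [Field F] [Fintype F] [DecidableEq F]

theorem sum_quadraticChar_sub_mul_sub (hF : ringChar F ≠ 2) {e f : F} (hef : e ≠ f) :
    ∑ u : F, quadraticChar F ((u - e) * (u - f)) = -1 := by
  have hd : f - e ≠ 0 := sub_ne_zero.2 hef.symm
  have hJ := jacobiSum_nontrivial_inv (quadraticChar_ne_one hF)
  rw [(quadraticChar_isQuadratic F).inv, jacobiSum] at hJ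
  have hbij : Function.Bijective fun x : F => e + (f - e) * x :=
    (AddGroup.addLeft_bijective e).comp (mulLeft_bijective₀ _ hd)
  rw [← hbij.sum_comp]
  have hterm : ∀ x : F, quadraticChar F ((e + (f - e) * x - e) * (e + (f - e) * x - f)) =
      quadraticChar F (-1) * (quadraticChar F x * quadraticChar F (1 - x)) := fun x => by
    have : (e + (f - e) * x - e) * (e + (f - e) * x - f) =
        (f - e) ^ 2 * (-1 * (x * (1 - x))) := by ring
    rw [this, map_mul, quadraticChar_sq_one' hd, one_mul, map_mul, map_mul]
  have h1 := quadraticChar_sq_one (neg_ne_zero.2 (one_ne_zero (α := F)))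
  rw [Finset.sum_congr rfl fun x _ => hterm x, ← Finset.mul_sum, hJ]
  linear_combination -h1

theorem sum_quadraticChar_sub (hF : ringChar F ≠ 2) (e : F) :
    ∑ u : F, quadraticChar F (u - e) = 0 := by
  rw [← quadraticChar_sum_zero hF]
  exact (Equiv.subRight e).sum_comp fun u => quadraticChar F u

/-- If the pairwise differences of `e`, `f`, `g` are squares, then the nontrivial 2-descent class
`(-1, -1, 1)` is attained on the curve `w² = (u - e)(u - f)(u - g)`. -/
theorem exists_quadraticChar_eq (hF : ringChar F ≠ 2) {e f g : F} (hef : e ≠ f) (heg : e ≠ g)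
    (hfg : f ≠ g) (sfe : IsSquare (f - e)) (sef : IsSquare (e - f)) (sge : IsSquare (g - e)) :
    ∃ u : F, quadraticChar F (u - e) = -1 ∧ quadraticChar F (u - f) = -1 ∧
      quadraticChar F (u - g) = 1 := by
  set χ := quadraticChar F
  by_contra! hcon
  have key : ∀ u : F, (1 - χ (u - e)) * (1 - χ (u - f)) * (1 + χ (u - g)) = 0 := fun u => by
    by_cases he : u = e
    · have : χ (u - f) = 1 :=
        (quadraticChar_one_iff_isSquare (by rw [he]; exact sub_ne_zero.2 hef)).2 (he ▸ sef)
      simp [this]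
    by_cases hf : u = f
    · have : χ (u - e) = 1 :=
        (quadraticChar_one_iff_isSquare (by rw [hf]; exact sub_ne_zero.2 hef.symm)).2 (hf ▸ sfe)
      simp [this]
    by_cases hg : u = g
    · have : χ (u - e) = 1 :=
        (quadraticChar_one_iff_isSquare (by rw [hg]; exact sub_ne_zero.2 heg.symm)).2 (hg ▸ sge)
      simp [this]
    rcases quadraticChar_dichotomy (sub_ne_zero.2 he) with h | h <;>
    rcases quadraticChar_dichotomy (sub_ne_zero.2 hf) with h' | h' <;>
    rcases quadraticChar_dichotomy (sub_ne_zero.2 hg) with h'' | h'' <;>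
    first
    | exact absurd h'' (hcon u h h')
    | simp [χ, h, h', h'']
  have hle : ∀ u : F, 0 ≤ 1 + χ ((u - e) * (u - f) * (u - g)) := fun u => by
    by_cases h : (u - e) * (u - f) * (u - g) = 0
    · simp [χ, h]
    · rcases quadraticChar_dichotomy h with h | h <;> simp [χ, h]
  have hsum := Finset.sum_nonneg fun u (_ : u ∈ Finset.univ) => hle u
  have hexp : ∀ u : F, 1 + χ ((u - e) * (u - f) * (u - g)) =
      (1 - χ (u - e)) * (1 - χ (u - f)) * (1 + χ (u - g))
      + χ (u - e) + χ (u - f) - χ (u - g) - χ ((u - e) * (u - f))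
      + χ ((u - e) * (u - g)) + χ ((u - f) * (u - g)) := fun u => by
    simp only [map_mul]; ring
  have hexp' : ∀ u : F, 1 + χ ((u - e) * (u - f) * (u - g)) =
      χ (u - e) + χ (u - f) - χ (u - g) - χ ((u - e) * (u - f))
      + χ ((u - e) * (u - g)) + χ ((u - f) * (u - g)) := fun u => by
    rw [hexp, key, zero_add]
  rw [Finset.sum_congr rfl fun u _ => hexp' u] at hsum
  simp only [Finset.sum_add_distrib, Finset.sum_sub_distrib, χ, sum_quadraticChar_sub hF,
    sum_quadraticChar_sub_mul_sub hF hef, sum_quadraticChar_sub_mul_sub hF heg,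
    sum_quadraticChar_sub_mul_sub hF hfg] at hsum
  norm_num at hsum

end FiniteField

section HilbertSymbol

variable {k : Type*} [Field k] {A B c : k}

theorem HilbertTrivial.symm (h : HilbertTrivial A B) : HilbertTrivial B A :=
  let ⟨r, s, h⟩ := h
  ⟨s, r, by rw [add_comm, h]⟩

theorem hilbertTrivial_mul_sq_left (hc : c ≠ 0) :
    HilbertTrivial (A * c ^ 2) B ↔ HilbertTrivial A B := by
  constructor
  · rintro ⟨r, s, h⟩
    exact ⟨c * r, s, by rw [← h]; ring⟩
  · rintro ⟨r, s, h⟩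
    exact ⟨r / c, s, by rw [← h]; field_simp⟩

theorem hilbertTrivial_mul_sq_right (hc : c ≠ 0) :
    HilbertTrivial A (B * c ^ 2) ↔ HilbertTrivial A B :=
  ⟨fun h => ((hilbertTrivial_mul_sq_left hc).1 h.symm).symm,
    fun h => ((hilbertTrivial_mul_sq_left hc).2 h.symm).symm⟩

theorem HilbertTrivial.of_isSquare_right (hB : IsSquare B) (h0 : B ≠ 0) : HilbertTrivial A B := by
  obtain ⟨t, rfl⟩ := hB
  have : t ≠ 0 := by rintro rfl; simp at h0
  exact ⟨0, t⁻¹, by field_simp; simp⟩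

theorem HilbertTrivial.of_isSquare_left (hA : IsSquare A) (h0 : A ≠ 0) : HilbertTrivial A B :=
  (HilbertTrivial.of_isSquare_right hA h0).symm

theorem hilbertTrivial_self (h2 : (2 : k) ≠ 0) (hneg : IsSquare (-1 : k)) (h0 : A ≠ 0) :
    HilbertTrivial A A := by
  obtain ⟨i, hi⟩ := hneg
  have hi0 : i ≠ 0 := by rintro rfl; simp at hi
  refine ⟨(A⁻¹ + 1) / 2, (A⁻¹ - 1) / (2 * i), ?_⟩
  have hi' : i ^ 2 = -1 := by rw [sq, hi]
  rw [div_pow, div_pow, mul_pow, hi']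
  field_simp
  ring

end HilbertSymbol

section Padic

variable {p : ℕ} [hpp : Fact p.Prime]

theorem PadicInt.exists_coe_eq {x : ℚ_[p]} (hx : ‖x‖ ≤ 1) : ∃ y : ℤ_[p], (y : ℚ_[p]) = x :=
  ⟨⟨x, hx⟩, rfl⟩

theorem PadicInt.norm_lt_one_iff_toZMod_eq_zero (x : ℤ_[p]) :
    ‖x‖ < 1 ↔ PadicInt.toZMod x = 0 := by
  rw [← RingHom.mem_ker, PadicInt.ker_toZMod, IsLocalRing.mem_maximalIdeal,
    PadicInt.mem_nonunits]

theorem PadicInt.norm_eq_one_iff_toZMod_ne_zero (x : ℤ_[p]) :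
    ‖x‖ = 1 ↔ PadicInt.toZMod x ≠ 0 := by
  rw [Ne, ← PadicInt.norm_lt_one_iff_toZMod_eq_zero, not_lt]
  exact ⟨fun h => h.ge, fun h => le_antisymm (PadicInt.norm_le_one x) h⟩

theorem PadicInt.isSquare_of_isSquare_toZMod (hp : 2 < p) {x : ℤ_[p]}
    (h0 : PadicInt.toZMod x ≠ 0) (hx : IsSquare (PadicInt.toZMod x)) : IsSquare x := by
  obtain ⟨t, ht⟩ := hx
  obtain ⟨T, rfl⟩ := ZMod.ringHom_surjective (PadicInt.toZMod (p := p)) t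
  have hT : PadicInt.toZMod T ≠ 0 := fun h => h0 (by rw [ht, h, zero_mul])
  have h2 : (2 : ZMod p) ≠ 0 := by
    have := ZMod.prime_ne_zero p 2
    simpa using this (by omega)
  have hd : ‖2 * T‖ = 1 := by
    rw [PadicInt.norm_eq_one_iff_toZMod_ne_zero, map_mul, map_ofNat]
    exact mul_ne_zero h2 hT
  obtain ⟨z, hz, -⟩ := hensels_lemma (p := p) (F := Polynomial.X ^ 2 - Polynomial.C x) (a := T) (by
    simp only [map_sub, map_pow, Polynomial.aeval_X, Polynomial.aeval_C,
      Polynomial.derivative_X_pow, Polynomial.derivative_C, Algebra.algebraMap_self, RingHom.id_apply]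
    simp only [map_mul, map_pow, Polynomial.aeval_X, map_natCast]
    norm_num
    rw [← norm_mul, hd, one_pow, PadicInt.norm_lt_one_iff_toZMod_eq_zero, map_sub, map_pow, ht]
    ring)
  refine ⟨z, ?_⟩
  simp only [map_sub, map_pow, Polynomial.aeval_X, Polynomial.aeval_C, Algebra.algebraMap_self,
    RingHom.id_apply] at hz
  rw [← sq]
  exact (sub_eq_zero.1 hz).symm

theorem PadicInt.isSquare_coe_iff (hp : 2 < p) {x : ℤ_[p]} (h0 : PadicInt.toZMod x ≠ 0) :
    IsSquare (x : ℚ_[p]) ↔ IsSquare (PadicInt.toZMod x) := by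
  constructor
  · rintro ⟨t, ht⟩
    have hx : ‖(x : ℚ_[p])‖ = 1 := (PadicInt.norm_eq_one_iff_toZMod_ne_zero x).2 h0
    have hn : ‖t‖ ≤ 1 := by
      rw [ht, norm_mul] at hx
      nlinarith [norm_nonneg t]
    obtain ⟨T, rfl⟩ := PadicInt.exists_coe_eq hn
    refine ⟨PadicInt.toZMod T, ?_⟩
    rw [← map_mul]
    congr 1
    exact Subtype.ext ht
  · intro h
    exact (PadicInt.isSquare_of_isSquare_toZMod hp h0 h).map (PadicInt.Coe.ringHom (p := p))

theorem Padic.norm_eq_of_norm_sub_lt {x y : ℚ_[p]} (h : ‖x - y‖ < ‖y‖) : ‖x‖ = ‖y‖ := by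
  rw [← sub_add_cancel x y, Padic.add_eq_max_of_ne h.ne, max_eq_right h.le]

theorem Padic.isSquare_of_norm_sub_lt (hp : 2 < p) {x y : ℚ_[p]} (hy : IsSquare y)
    (hy1 : ‖y‖ = 1) (hxy : ‖x - y‖ < 1) : IsSquare x := by
  have hx1 : ‖x‖ = 1 := by
    rw [← hy1]
    exact Padic.norm_eq_of_norm_sub_lt (hy1.symm ▸ hxy)
  obtain ⟨x, rfl⟩ := PadicInt.exists_coe_eq hx1.le
  obtain ⟨y, rfl⟩ := PadicInt.exists_coe_eq hy1.le
  have hx0 := (PadicInt.norm_eq_one_iff_toZMod_ne_zero x).1 hx1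
  have hy0 := (PadicInt.norm_eq_one_iff_toZMod_ne_zero y).1 hy1
  have h : PadicInt.toZMod (x - y) = 0 :=
    (PadicInt.norm_lt_one_iff_toZMod_eq_zero _).1 (by simpa [PadicInt.norm_def] using hxy)
  rw [PadicInt.isSquare_coe_iff hp hy0] at hy
  rw [PadicInt.isSquare_coe_iff hp hx0]
  rw [map_sub, sub_eq_zero] at h
  rwa [h]

theorem hilbertTrivial_of_norm_eq_one (hp : 2 < p) {A B : ℚ_[p]} (hA : ‖A‖ = 1) (hB : ‖B‖ = 1) :
    HilbertTrivial A B := by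
  have lift_solution : ∀ (A B : ℤ_[p]) (r s : ZMod p), PadicInt.toZMod A ≠ 0 → r ≠ 0 →
      PadicInt.toZMod A * r ^ 2 + PadicInt.toZMod B * s ^ 2 = 1 →
      HilbertTrivial (A : ℚ_[p]) (B : ℚ_[p]) := fun A B r s hA0 hr h => by
    obtain ⟨S, rfl⟩ := ZMod.ringHom_surjective (PadicInt.toZMod (p := p)) s
    have hval : PadicInt.toZMod (A * (1 - B * S ^ 2)) = (PadicInt.toZMod A * r) ^ 2 := by
      simp only [map_mul, map_sub, map_one, map_pow]
      linear_combination -PadicInt.toZMod A * h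
    obtain ⟨t, ht⟩ := PadicInt.isSquare_of_isSquare_toZMod hp (x := A * (1 - B * S ^ 2))
      (by rw [hval]; exact pow_ne_zero _ (mul_ne_zero hA0 hr)) (by rw [hval]; exact IsSquare.sq _)
    have hA' : (A : ℚ_[p]) ≠ 0 := fun h0 => hA0 (by
      rw [show A = 0 from Subtype.coe_injective (h0.trans PadicInt.coe_zero.symm), map_zero])
    refine ⟨t / A, S, ?_⟩
    have ht' : (A : ℚ_[p]) * (1 - B * S ^ 2) = t * t := by exact_mod_cast congrArg Subtype.val ht
    field_simp
    linear_combination -ht'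
  obtain ⟨A, rfl⟩ := PadicInt.exists_coe_eq hA.le
  obtain ⟨B, rfl⟩ := PadicInt.exists_coe_eq hB.le
  have hA0 := (PadicInt.norm_eq_one_iff_toZMod_ne_zero A).1 hA
  have hB0 := (PadicInt.norm_eq_one_iff_toZMod_ne_zero B).1 hB
  obtain ⟨r, s, h⟩ := FiniteField.exists_root_sum_quadratic
    (f := Polynomial.C (PadicInt.toZMod A) * Polynomial.X ^ 2 +
      Polynomial.C 0 * Polynomial.X + Polynomial.C 0)
    (g := Polynomial.C (PadicInt.toZMod B) * Polynomial.X ^ 2 +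
      Polynomial.C 0 * Polynomial.X + Polynomial.C (-1))
    (Polynomial.degree_quadratic hA0) (Polynomial.degree_quadratic hB0)
    (by rw [ZMod.card]; exact Nat.odd_iff.1 (hpp.out.odd_of_ne_two hp.ne'))
  have h' : PadicInt.toZMod A * r ^ 2 + PadicInt.toZMod B * s ^ 2 = 1 := by
    simp at h
    linear_combination h
  by_cases hr : r = 0
  · have hs : s ≠ 0 := by
      rintro rfl
      simp [hr] at h'
    exact (lift_solution B A s r hB0 hs (by rw [add_comm, h'])).symm
  · exact lift_solution A B r s hA0 hr h'

theorem not_hilbertTrivial_inv_prime (hp : 2 < p) {B : ℚ_[p]} (hB : ‖B‖ = 1)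
    (hBs : ¬IsSquare B) : ¬HilbertTrivial (p : ℚ_[p])⁻¹ B := by
  have hB0 : B ≠ 0 := by rintro rfl; simp at hB
  have hp0 : (p : ℚ_[p]) ≠ 0 := Nat.cast_ne_zero.2 hpp.out.ne_zero
  rintro ⟨r, s, h⟩
  rcases lt_or_ge ‖(p : ℚ_[p])⁻¹ * r ^ 2‖ 1 with hlt | hge
  · have hsq : IsSquare (B * s ^ 2) :=
      Padic.isSquare_of_norm_sub_lt hp IsSquare.one norm_one (by
        rwa [← h, sub_add_cancel_right, norm_neg])
    have hs : s ≠ 0 := by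
      rintro rfl
      rw [zero_pow two_ne_zero, mul_zero, add_zero] at h
      rw [h, norm_one] at hlt
      exact hlt.false
    obtain ⟨t, ht⟩ := hsq
    exact hBs ⟨t / s, by field_simp; rw [ht, sq]⟩
  · have hr : r ≠ 0 := by
      rintro rfl
      norm_num at hge
    have hodd : ∀ t : ℚ_[p], t ≠ 0 → ‖(p : ℚ_[p])⁻¹ * r ^ 2‖ ≠ ‖t‖ ^ 2 := fun t ht heq => by
      rw [← norm_pow,
        Padic.norm_eq_zpow_neg_valuation (mul_ne_zero (inv_ne_zero hp0) (pow_ne_zero 2 hr)),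
        Padic.norm_eq_zpow_neg_valuation (pow_ne_zero 2 ht)] at heq
      have := zpow_right_injective₀ (by exact_mod_cast hpp.out.pos)
        (by exact_mod_cast hpp.out.one_lt.ne') heq
      rw [Padic.valuation_mul (inv_ne_zero hp0) (pow_ne_zero 2 hr), Padic.valuation_inv,
        Padic.valuation_pow, Padic.valuation_pow, Padic.valuation_p] at this
      push_cast at this
      omega
    have hgt : 1 < ‖(p : ℚ_[p])⁻¹ * r ^ 2‖ :=
      lt_of_le_of_ne hge fun h1 => hodd 1 one_ne_zero (by rw [← h1]; simp)
    have hs : ‖B * s ^ 2‖ = ‖(p : ℚ_[p])⁻¹ * r ^ 2‖ := by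
      rw [← norm_neg (B * s ^ 2)]
      apply Padic.norm_eq_of_norm_sub_lt
      rw [← norm_neg, neg_sub, sub_neg_eq_add, h, norm_one]
      exact hgt
    have hs0 : s ≠ 0 := by
      rintro rfl
      rw [← hs] at hgt
      norm_num at hgt
    refine hodd s hs0 ?_
    rw [← hs, norm_mul, hB, one_mul, norm_pow]

theorem Padic.isSquare_of_norm_sub_one_lt (hp : 2 < p) {x : ℚ_[p]} (h : ‖x - 1‖ < 1) :
    IsSquare x :=
  Padic.isSquare_of_norm_sub_lt hp IsSquare.one norm_one h

theorem Padic.isSquare_sub_mul_sub_of_one_lt_norm (hp : 2 < p) {u e f : ℚ_[p]} (hu : 1 < ‖u‖)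
    (he : ‖e‖ ≤ 1) (hf : ‖f‖ ≤ 1) : IsSquare ((u - e) * (u - f)) := by
  have hu0 : u ≠ 0 := by rintro rfl; norm_num at hu
  have hsq : ∀ c : ℚ_[p], ‖c‖ ≤ 1 → IsSquare (1 - c / u) := fun c hc => by
    refine Padic.isSquare_of_norm_sub_one_lt hp ?_
    rw [sub_sub_cancel_left, norm_neg, norm_div, div_lt_one (by positivity)]
    exact hc.trans_lt hu
  have : (u - e) * (u - f) = u ^ 2 * ((1 - e / u) * (1 - f / u)) := by field_simp
  rw [this]
  exact (IsSquare.sq u).mul ((hsq e he).mul (hsq f hf))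

theorem Padic.norm_sub_le_one {x y : ℚ_[p]} (hx : ‖x‖ ≤ 1) (hy : ‖y‖ ≤ 1) : ‖x - y‖ ≤ 1 := by
  rw [sub_eq_add_neg]
  exact (Padic.nonarchimedean x (-y)).trans (max_le hx (by rwa [norm_neg]))

theorem Padic.norm_add_lt_one {x y : ℚ_[p]} (hx : ‖x‖ < 1) (hy : ‖y‖ < 1) : ‖x + y‖ < 1 :=
  (Padic.nonarchimedean x y).trans_lt (max_lt hx hy)

/-- The symbols `((x - 1)(x - β), B)` with `β ≡ 1` that can occur on the normalized surface. -/
theorem hilbertTrivial_sub_one_mul_sub (hp : 2 < p) (hneg : IsSquare (-1 : ℚ_[p]))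
    {β x B g z : ℚ_[p]} (hβ : ‖1 - β‖ < 1) (hz : z ≠ 0)
    (hsurf : z ^ 2 = x * (x - 1) * (x - β) * g)
    (hB : (B ≠ 0 ∧ IsSquare B) ∨ (B ≠ 0 ∧ IsSquare (B * g)) ∨ (‖B‖ = 1 ∧ ‖g‖ = 1)) :
    HilbertTrivial ((x - 1) * (x - β)) B := by
  rcases hB with ⟨hB0, hB⟩ | hB
  · exact .of_isSquare_right hB hB0
  have hz2 : x * (x - 1) * (x - β) * g ≠ 0 := hsurf ▸ pow_ne_zero 2 hz
  have hA0 : (x - 1) * (x - β) ≠ 0 := fun h => hz2 (by linear_combination x * g * h)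
  have hx0 : x ≠ 0 := by rintro rfl; simp at hz2
  have hg0 : g ≠ 0 := by rintro rfl; simp at hz2
  have h2 : (2 : ℚ_[p]) ≠ 0 := two_ne_zero
  have hβ1 : ‖β‖ = 1 := by
    rw [← norm_one (α := ℚ_[p])]
    exact Padic.norm_eq_of_norm_sub_lt (by rwa [norm_sub_rev, norm_one])
  rcases lt_trichotomy ‖x‖ 1 with hx | hx | hx
  · refine .of_isSquare_left (IsSquare.mul ?_ ?_) hA0
    · exact Padic.isSquare_of_norm_sub_lt hp hneg (by simp) (by simpa using hx)
    · refine Padic.isSquare_of_norm_sub_lt hp hneg (by simp) ?_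
      rw [show x - β - -1 = x + (1 - β) by ring]
      exact Padic.norm_add_lt_one hx hβ
  · rcases hB with ⟨hB0, w, hw⟩ | ⟨hB1, hg1⟩
    · have hw0 : w ≠ 0 := by rintro rfl; simp [hB0, hg0] at hw
      have hBA : B = x * ((x - 1) * (x - β)) * (w / z) ^ 2 := by
        rw [div_pow, hsurf]
        field_simp at hA0 ⊢
        have h1 : x - 1 ≠ 0 := left_ne_zero_of_mul hA0
        have h3 : x - β ≠ 0 := right_ne_zero_of_mul hA0
        field_simp
        linear_combination hw
      have hwz : w / z ≠ 0 := div_ne_zero hw0 hz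
      rw [hBA]
      rcases (Padic.norm_sub_le_one hx.le (norm_one (α := ℚ_[p])).le).lt_or_eq with hx1 | hx1
      · obtain ⟨y, hy⟩ := Padic.isSquare_of_norm_sub_one_lt hp hx1
        have hy0 : y ≠ 0 := by rintro rfl; simp at hy; exact hx0 hy
        rw [show x * ((x - 1) * (x - β)) * (w / z) ^ 2 =
          ((x - 1) * (x - β)) * (y * (w / z)) ^ 2 by nth_rewrite 1 [hy]; ring]
        rw [hilbertTrivial_mul_sq_right (mul_ne_zero hy0 hwz)]
        exact hilbertTrivial_self h2 hneg hA0
      · rw [hilbertTrivial_mul_sq_right hwz]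
        have hxβ : ‖x - β‖ = 1 := by
          rw [← hx1]
          refine Padic.norm_eq_of_norm_sub_lt ?_
          rwa [show x - β - (x - 1) = 1 - β by ring, hx1]
        exact hilbertTrivial_of_norm_eq_one hp (by rw [norm_mul, hx1, hxβ, one_mul])
          (by rw [norm_mul, norm_mul, hx, hx1, hxβ]; norm_num)
    · have hA : (x - 1) * (x - β) = (x * g) * (z / (x * g)) ^ 2 := by
        rw [div_pow, hsurf]
        field_simp
      rw [hA, hilbertTrivial_mul_sq_left (div_ne_zero hz (mul_ne_zero hx0 hg0))]
      exact hilbertTrivial_of_norm_eq_one hp (by rw [norm_mul, hx, hg1, one_mul]) hB1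
  · exact .of_isSquare_left (Padic.isSquare_sub_mul_sub_of_one_lt_norm hp hx norm_one.le hβ1.le) hA0

/-- On a curve `w² = u(u - 1)(u - l)` with good reduction and square differences of roots, both
descent functions fall under the cases of `hilbertTrivial_sub_one_mul_sub`. -/
theorem descent_alternatives (hp : 2 < p) (hneg : IsSquare (-1 : ℚ_[p])) {l u : ℚ_[p]}
    (hl : ‖l‖ = 1) (hl' : ‖1 - l‖ = 1) (hls : IsSquare l) (hls' : IsSquare (1 - l))
    (hu : u * (u - 1) * (u - l) ≠ 0) {B : ℚ_[p]}
    (hB : B = (u - 1) * (u - l) ∨ B = u * (u - l)) :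
    (B ≠ 0 ∧ IsSquare B) ∨ (B ≠ 0 ∧ IsSquare (B * (u * (u - 1) * (u - l)))) ∨
      (‖B‖ = 1 ∧ ‖u * (u - 1) * (u - l)‖ = 1) := by
  have hB0 : B ≠ 0 := by
    rcases hB with rfl | rfl <;> intro h <;> apply hu
    · linear_combination u * h
    · linear_combination (u - 1) * h
  have hrev : ‖l - 1‖ = 1 := by rwa [norm_sub_rev]
  have hlsrev : IsSquare (l - 1) := by
    rw [show l - 1 = -1 * (1 - l) by ring]; exact hneg.mul hls'
  have h1 : (‖(1 : ℚ_[p])‖) ≤ 1 := norm_one.le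
  rcases lt_trichotomy ‖u‖ 1 with hu1 | hu1 | hu1
  · have hs1 : IsSquare (u - 1) :=
      Padic.isSquare_of_norm_sub_lt hp hneg (by simp) (by simpa using hu1)
    rcases hB with rfl | rfl
    · refine .inl ⟨hB0, hs1.mul ?_⟩
      refine Padic.isSquare_of_norm_sub_lt hp (hneg.mul hls) (by simpa using hl) ?_
      simpa using hu1
    · refine .inr (.inl ⟨hB0, ?_⟩)
      rw [show u * (u - l) * (u * (u - 1) * (u - l)) = (u * (u - l)) ^ 2 * (u - 1) by ring]
      exact (IsSquare.sq _).mul hs1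
  · rcases (Padic.norm_sub_le_one hu1.le h1).lt_or_eq with hn1 | hn1
    · have hus : IsSquare u := Padic.isSquare_of_norm_sub_one_lt hp hn1
      rcases hB with rfl | rfl
      · refine .inr (.inl ⟨hB0, ?_⟩)
        rw [show (u - 1) * (u - l) * (u * (u - 1) * (u - l)) = ((u - 1) * (u - l)) ^ 2 * u by ring]
        exact (IsSquare.sq _).mul hus
      · refine .inl ⟨hB0, hus.mul (Padic.isSquare_of_norm_sub_lt hp hls' hl' ?_)⟩
        rwa [sub_sub_sub_cancel_right]
    rcases (Padic.norm_sub_le_one hu1.le hl.le).lt_or_eq with hnl | hnl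
    · refine .inr (.inl ⟨hB0, ?_⟩)
      rcases hB with rfl | rfl
      · rw [show (u - 1) * (u - l) * (u * (u - 1) * (u - l)) = ((u - 1) * (u - l)) ^ 2 * u by ring]
        exact (IsSquare.sq _).mul (Padic.isSquare_of_norm_sub_lt hp hls hl hnl)
      · rw [show u * (u - l) * (u * (u - 1) * (u - l)) = (u * (u - l)) ^ 2 * (u - 1) by ring]
        refine (IsSquare.sq _).mul (Padic.isSquare_of_norm_sub_lt hp hlsrev hrev ?_)
        rwa [sub_sub_sub_cancel_right]
    · refine .inr (.inr ⟨?_, by simp [hu1, hn1, hnl]⟩)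
      rcases hB with rfl | rfl <;> simp [hu1, hn1, hnl]
  · refine .inl ⟨hB0, ?_⟩
    rcases hB with rfl | rfl
    · exact Padic.isSquare_sub_mul_sub_of_one_lt_norm hp hu1 h1 hl.le
    · simpa using Padic.isSquare_sub_mul_sub_of_one_lt_norm hp hu1 (e := 0) (by simp) hl.le

theorem Padic.exists_unit_not_isSquare (hp : 2 < p) {e f g : ℚ_[p]} (he : ‖e‖ ≤ 1) (hf : ‖f‖ ≤ 1)
    (hg : ‖g‖ ≤ 1) (hef : ‖e - f‖ = 1) (heg : ‖e - g‖ = 1) (hfg : ‖f - g‖ = 1)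
    (sfe : IsSquare (f - e)) (sef : IsSquare (e - f)) (sge : IsSquare (g - e)) :
    ∃ u : ℚ_[p], ‖u - e‖ = 1 ∧ ‖u - f‖ = 1 ∧ ¬IsSquare (u - e) ∧ ¬IsSquare (u - f) ∧
      u ≠ g ∧ IsSquare (u - g) ∧ IsSquare ((u - e) * (u - f)) := by
  obtain ⟨e, rfl⟩ := PadicInt.exists_coe_eq he
  obtain ⟨f, rfl⟩ := PadicInt.exists_coe_eq hf
  obtain ⟨g, rfl⟩ := PadicInt.exists_coe_eq hg
  have hchar : ringChar (ZMod p) ≠ 2 := by rw [ZMod.ringChar_zmod_n]; omega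
  have hne : ∀ x y : ℤ_[p], ‖(x : ℚ_[p]) - y‖ = 1 → PadicInt.toZMod (x - y) ≠ 0 := fun x y h =>
    (PadicInt.norm_eq_one_iff_toZMod_ne_zero _).1 (by rw [PadicInt.norm_def, PadicInt.coe_sub, h])
  have hsq : ∀ x y : ℤ_[p], PadicInt.toZMod (x - y) ≠ 0 →
      (IsSquare ((x : ℚ_[p]) - y) ↔ IsSquare (PadicInt.toZMod x - PadicInt.toZMod y)) :=
    fun x y h => by
      rw [← PadicInt.coe_sub, PadicInt.isSquare_coe_iff hp h, map_sub]
  have hef' := hne _ _ hef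
  have heg' := hne _ _ heg
  have hfg' := hne _ _ hfg
  have hfe' := hne f e (by rwa [norm_sub_rev] at hef)
  have hge' := hne g e (by rwa [norm_sub_rev] at heg)
  rw [hsq _ _ hef'] at sef
  rw [hsq _ _ hfe'] at sfe
  rw [hsq _ _ hge'] at sge
  rw [map_sub, sub_ne_zero] at hef' heg' hfg'
  obtain ⟨u, h1, h2, h3⟩ := exists_quadraticChar_eq hchar hef' heg' hfg' sfe sef sge
  obtain ⟨u, rfl⟩ := ZMod.ringHom_surjective (PadicInt.toZMod (p := p)) u
  have hnz : ∀ x : ℤ_[p], quadraticChar (ZMod p) (PadicInt.toZMod u - PadicInt.toZMod x) ≠ 0 →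
      PadicInt.toZMod (u - x) ≠ 0 := fun x h h0 => h (by
    rw [← map_sub, h0, quadraticChar_zero])
  have hue := hnz e (by rw [h1]; norm_num)
  have huf := hnz f (by rw [h2]; norm_num)
  have hug := hnz g (by rw [h3]; norm_num)
  have hnorm : ∀ x : ℤ_[p], PadicInt.toZMod (u - x) ≠ 0 → ‖(u : ℚ_[p]) - x‖ = 1 := fun x h => by
    rw [← PadicInt.coe_sub, ← PadicInt.norm_def]
    exact (PadicInt.norm_eq_one_iff_toZMod_ne_zero _).2 h
  have hprod : PadicInt.toZMod ((u - e) * (u - f)) ≠ 0 := by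
    rw [map_mul]; exact mul_ne_zero hue huf
  refine ⟨u, hnorm e hue, hnorm f huf, ?_, ?_, ?_, ?_, ?_⟩
  · rw [hsq _ _ hue]
    exact quadraticChar_neg_one_iff_not_isSquare.1 h1
  · rw [hsq _ _ huf]
    exact quadraticChar_neg_one_iff_not_isSquare.1 h2
  · intro h
    have := hnorm g hug
    rw [h, sub_self, norm_zero] at this
    exact zero_ne_one this
  · rw [hsq _ _ hug]
    rw [map_sub] at hug
    exact (quadraticChar_one_iff_isSquare hug).1 h3
  · rw [← PadicInt.coe_sub, ← PadicInt.coe_sub, ← PadicInt.coe_mul,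
      PadicInt.isSquare_coe_iff hp hprod, ← quadraticChar_one_iff_isSquare hprod, map_mul, map_mul,
      map_sub PadicInt.toZMod, map_sub PadicInt.toZMod, h1, h2]
    norm_num

/-- The multiplicative curve `y² = x(x - 1)(x - β)` has a point at which the descent function
`x(x - β)` has odd valuation. -/
theorem exists_mul_sub_eq_inv_prime_mul_sq (hp : 2 < p) {β : ℚ_[p]} (hβ : ‖1 - β‖ < 1)
    (hβ1 : β ≠ 1) (hβs : IsSquare (1 - β)) :
    ∃ x q y : ℚ_[p], q ≠ 0 ∧ y ≠ 0 ∧ x * (x - β) = (p : ℚ_[p])⁻¹ * q ^ 2 ∧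
      x * (x - 1) * (x - β) = y ^ 2 := by
  have hp0 : (p : ℚ_[p]) ≠ 0 := Nat.cast_ne_zero.2 hpp.out.ne_zero
  obtain ⟨m, hm⟩ := hβs
  have hm0 : m ≠ 0 := by
    rintro rfl
    exact hβ1 (by linear_combination -hm)
  obtain rfl : β = 1 - m ^ 2 := by linear_combination -hm
  rw [sub_sub_cancel, norm_pow] at hβ
  have hm1 : ‖m‖ < 1 := by
    by_contra! h
    nlinarith
  have hmp : ‖m / p‖ ≤ 1 := by
    have hval : 0 < m.valuation := by
      rw [Padic.norm_eq_zpow_neg_valuation hm0] at hm1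
      by_contra! h
      exact absurd hm1 (not_lt.2 (one_le_zpow₀ (by exact_mod_cast hpp.out.one_lt.le) (by omega)))
    rw [Padic.norm_le_one_iff_val_nonneg, div_eq_mul_inv,
      Padic.valuation_mul hm0 (inv_ne_zero hp0), Padic.valuation_inv, Padic.valuation_p]
    omega
  have hmm : ‖m ^ 2 / p‖ < 1 := by
    rw [sq, mul_div_assoc, norm_mul]
    nlinarith [norm_nonneg m]
  have hm2 : ‖-m ^ 2‖ < 1 := by rwa [norm_neg, norm_pow]
  have hx : ‖(1 - m ^ 2 + m ^ 2 / p) - 1‖ < 1 := by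
    rw [show (1 - m ^ 2 + m ^ 2 / p) - 1 = -m ^ 2 + m ^ 2 / p by ring]
    exact Padic.norm_add_lt_one hm2 hmm
  obtain ⟨r, hr⟩ := Padic.isSquare_of_norm_sub_one_lt hp hx
  have hr0 : r ≠ 0 := by
    rintro rfl
    rw [hr] at hx
    norm_num at hx
  have h1p : ‖((1 : ℚ_[p]) - p) - 1‖ < 1 := by
    rw [sub_sub_cancel_left, norm_neg]
    exact Padic.norm_p_lt_one
  obtain ⟨t, ht⟩ := Padic.isSquare_of_norm_sub_one_lt hp h1p
  have ht0 : t ≠ 0 := by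
    rintro rfl
    rw [ht] at h1p
    norm_num at h1p
  refine ⟨r * r, r * m, r * m ^ 2 * t / p, mul_ne_zero hr0 hm0, by simp [hr0, hm0, ht0, hp0],
    ?_, ?_⟩
  · rw [← hr, mul_pow, sq r, ← hr]
    field_simp
    ring
  · rw [div_pow, mul_pow, mul_pow, sq t, ← ht, sq r, ← hr]
    field_simp
    ring

end Padic

section Evaluation

variable {k : Type*} [Field k] {a β a' l : k}

theorem evMap_mul (ha : a ≠ 0) (ha' : a' ≠ 0) (ε : Fin 4 → ZMod 2) (x u : k) :
    evMap a (a * β) a' (a' * l) ε (a * x) (a' * u) = evMap 1 β 1 l ε x u := by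
  classical
  unfold evMap
  refine Finset.sum_congr rfl fun i _ => ?_
  have hscale : ∀ A B A' B' : k, A' = A * a ^ 2 → B' = B * a' ^ 2 →
      (HilbertTrivial A' B' ↔ HilbertTrivial A B) := fun A B A' B' hA hB => by
    rw [hA, hB, hilbertTrivial_mul_sq_left ha, hilbertTrivial_mul_sq_right ha']
  have hiff : HilbertTrivial (symPair a (a * β) a' (a' * l) (a * x) (a' * u) i).1
        (symPair a (a * β) a' (a' * l) (a * x) (a' * u) i).2 ↔
      HilbertTrivial (symPair 1 β 1 l x u i).1 (symPair 1 β 1 l x u i).2 := by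
    apply hscale <;> fin_cases i <;> simp [symPair] <;> ring
  exact if_congr hiff rfl rfl

theorem filter_stdBasis (i : Fin 4) :
    Finset.univ.filter (fun j : Fin 4 => stdBasis i j = 1) = {i} := by
  unfold stdBasis
  revert i
  decide

theorem filter_stdBasis_add :
    Finset.univ.filter (fun j : Fin 4 => (stdBasis 2 + stdBasis 3) j = 1) = {2, 3} := by
  unfold stdBasis
  decide

open Classical in
theorem evMap_stdBasis (a b a' b' x u : k) (i : Fin 4) :
    evMap a b a' b' (stdBasis i) x u =
      if HilbertTrivial (symPair a b a' b' x u i).1 (symPair a b a' b' x u i).2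
        then (0 : ZMod 2) else 1 := by
  rw [evMap, filter_stdBasis, Finset.sum_singleton]

theorem evMap_stdBasis_add (a b a' b' x u : k) :
    evMap a b a' b' (stdBasis 2 + stdBasis 3) x u =
      evMap a b a' b' (stdBasis 2) x u + evMap a b a' b' (stdBasis 3) x u := by
  rw [evMap_stdBasis, evMap_stdBasis, evMap, filter_stdBasis_add, Finset.sum_pair (by decide)]

theorem isSquare_SZMatrix {a b a' b' : k} (hker : ∀ ε, IsKernelVector a b a' b' ε) (i j : Fin 4) :
    IsSquare (SZMatrix a b a' b' i j) := by
  simpa [filter_stdBasis] using hker (stdBasis j) i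

end Evaluation

section Normalized

variable {p : ℕ} [hpp : Fact p.Prime] {β l : ℚ_[p]}

theorem evMap_normalized_eq_zero (hp : 2 < p) (hneg : IsSquare (-1 : ℚ_[p])) (hβ : ‖1 - β‖ < 1)
    (hl : ‖l‖ = 1) (hl' : ‖1 - l‖ = 1) (hls : IsSquare l) (hls' : IsSquare (1 - l))
    {x u z : ℚ_[p]} (hz : z ≠ 0)
    (hsurf : z ^ 2 = x * (x - 1) * (x - β) * (u * (u - 1) * (u - l))) :
    evMap 1 β 1 l (stdBasis 0) x u = 0 ∧ evMap 1 β 1 l (stdBasis 1) x u = 0 := by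
  have hu : u * (u - 1) * (u - l) ≠ 0 := fun h => by simp [h, hz] at hsurf
  have key : ∀ B, B = (u - 1) * (u - l) ∨ B = u * (u - l) →
      HilbertTrivial ((x - 1) * (x - β)) B := fun B hB =>
    hilbertTrivial_sub_one_mul_sub hp hneg hβ hz hsurf
      (descent_alternatives hp hneg hl hl' hls hls' hu hB)
  rw [evMap_stdBasis, evMap_stdBasis]
  exact ⟨if_pos (key _ (.inl rfl)), if_pos (key _ (.inr rfl))⟩

theorem exists_evMap_normalized_eq_zero (hp : 2 < p) (hβ : ‖1 - β‖ < 1) (hl : ‖l‖ = 1) :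
    ∃ x u z : ℚ_[p], z ≠ 0 ∧ z ^ 2 = x * (x - 1) * (x - β) * (u * (u - 1) * (u - l)) ∧
      evMap 1 β 1 l (stdBasis 2) x u = 0 ∧ evMap 1 β 1 l (stdBasis 3) x u = 0 := by
  have hβ1 : ‖β‖ = 1 := by
    rw [← norm_one (α := ℚ_[p])]
    exact Padic.norm_eq_of_norm_sub_lt (by rwa [norm_sub_rev, norm_one])
  have hp0 : (p : ℚ_[p]) ≠ 0 := Nat.cast_ne_zero.2 hpp.out.ne_zero
  set x : ℚ_[p] := (p : ℚ_[p])⁻¹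
  have hx : 1 < ‖x‖ := by
    rw [norm_inv]
    exact (one_lt_inv₀ (norm_pos_iff.2 hp0)).2 Padic.norm_p_lt_one
  have hx0 : x ≠ 0 := inv_ne_zero hp0
  have hne : ∀ c : ℚ_[p], ‖c‖ ≤ 1 → x - c ≠ 0 := fun c hc h => by
    rw [sub_eq_zero.1 h] at hx
    exact hx.not_ge hc
  have h1 : ‖(1 : ℚ_[p])‖ ≤ 1 := norm_one.le
  have hsq : ∀ c d : ℚ_[p], ‖c‖ ≤ 1 → ‖d‖ ≤ 1 → IsSquare ((x - c) * (x - d)) := fun c d =>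
    Padic.isSquare_sub_mul_sub_of_one_lt_norm hp hx
  obtain ⟨r, hr⟩ := hsq 1 β h1 hβ1.le
  obtain ⟨s, hs⟩ := hsq 1 l h1 hl.le
  have hr0 : r ≠ 0 := by rintro rfl; simp [hne 1 h1, hne β hβ1.le] at hr
  have hs0 : s ≠ 0 := by rintro rfl; simp [hne 1 h1, hne l hl.le] at hs
  have hA : HilbertTrivial (x * (x - β)) ((x - 1) * (x - l)) ∧
      HilbertTrivial (x * (x - β)) (x * (x - l)) := by
    have : IsSquare (x * (x - β)) := by simpa using hsq 0 β (by simp) hβ1.le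
    have h0 := mul_ne_zero hx0 (hne β hβ1.le)
    exact ⟨.of_isSquare_left this h0, .of_isSquare_left this h0⟩
  refine ⟨x, x, x * r * s, mul_ne_zero (mul_ne_zero hx0 hr0) hs0, ?_, ?_, ?_⟩
  · linear_combination -x ^ 2 * s ^ 2 * hr - x ^ 2 * (x - 1) * (x - β) * hs
  · rw [evMap_stdBasis]
    exact if_pos hA.1
  · rw [evMap_stdBasis]
    exact if_pos hA.2

/-- Each of the last two symbols can be made nontrivial while the other one is trivial. -/
theorem exists_evMap_normalized_eq_one (hp : 2 < p) (hneg : IsSquare (-1 : ℚ_[p]))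
    (hβ : ‖1 - β‖ < 1) (hβ1 : β ≠ 1) (hβs : IsSquare (1 - β))
    (hl : ‖l‖ = 1) (hl' : ‖1 - l‖ = 1) (hls : IsSquare l) (hls' : IsSquare (1 - l)) :
    (∃ x u z : ℚ_[p], z ≠ 0 ∧ z ^ 2 = x * (x - 1) * (x - β) * (u * (u - 1) * (u - l)) ∧
      evMap 1 β 1 l (stdBasis 2) x u = 1 ∧ evMap 1 β 1 l (stdBasis 3) x u = 0) ∧
    ∃ x u z : ℚ_[p], z ≠ 0 ∧ z ^ 2 = x * (x - 1) * (x - β) * (u * (u - 1) * (u - l)) ∧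
      evMap 1 β 1 l (stdBasis 2) x u = 0 ∧ evMap 1 β 1 l (stdBasis 3) x u = 1 := by
  have h1 : ‖(1 : ℚ_[p])‖ ≤ 1 := norm_one.le
  obtain ⟨x, q, y, hq, hy, hA, hf⟩ := exists_mul_sub_eq_inv_prime_mul_sq hp hβ hβ1 hβs
  have hrev : IsSquare (l - 1) := by
    rw [show l - 1 = -1 * (1 - l) by ring]; exact hneg.mul hls'
  have hnegl : IsSquare (-l) := by rw [← neg_one_mul]; exact hneg.mul hls
  have hnontriv : ∀ c d : ℚ_[p], d ≠ 0 → IsSquare d → ‖c‖ = 1 → ¬IsSquare c →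
      ¬HilbertTrivial (x * (x - β)) (c * d) := fun c d hd0 hd hc hcs => by
    obtain ⟨t, rfl⟩ := hd
    have ht : t ≠ 0 := by rintro rfl; simp at hd0
    rw [hA, hilbertTrivial_mul_sq_left hq, ← sq, hilbertTrivial_mul_sq_right ht]
    exact not_hilbertTrivial_inv_prime hp hc hcs
  constructor
  · obtain ⟨u, hu0, hul, -, hsl, hu1, ⟨s, hs⟩, ⟨t, ht⟩⟩ :=
      Padic.exists_unit_not_isSquare hp (e := 0) (f := l) (g := 1) (by simp) hl.le h1
        (by simpa using hl) (by simp) (by rwa [norm_sub_rev]) (by simpa using hls)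
        (by simpa using hnegl) (by simp)
    have hd0 : (u - 1) ≠ 0 := sub_ne_zero.2 hu1
    have hs0 : s ≠ 0 := by rintro rfl; simp [hd0] at hs
    have hp0 : (u - 0) * (u - l) ≠ 0 := by rw [← norm_pos_iff, norm_mul, hu0, hul]; norm_num
    have ht0 : t ≠ 0 := by rintro rfl; rw [ht] at hp0; simp at hp0
    refine ⟨x, u, y * s * t, mul_ne_zero (mul_ne_zero hy hs0) ht0, ?_, ?_, ?_⟩
    · rw [hf]
      linear_combination -y ^ 2 * t ^ 2 * hs - y ^ 2 * (u - 1) * ht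
    · rw [evMap_stdBasis]
      refine if_neg ?_
      change ¬HilbertTrivial (x * (x - β)) ((u - 1) * (u - l))
      rw [mul_comm (u - 1)]
      exact hnontriv _ _ hd0 ⟨s, hs⟩ hul hsl
    · rw [evMap_stdBasis]
      refine if_pos (.of_isSquare_right ?_ ?_)
      · exact ⟨t, by rw [← ht, sub_zero]; rfl⟩
      · rwa [sub_zero] at hp0
  · obtain ⟨u, hu0, hul, -, hsl, hu1, ⟨s, hs⟩, ⟨t, ht⟩⟩ :=
      Padic.exists_unit_not_isSquare hp (e := 1) (f := l) (g := 0) h1 hl.le (by simp)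
        hl' (by simp) (by simpa using hl) hrev hls' (by simpa using hneg)
    rw [sub_zero] at hs
    have hs0 : s ≠ 0 := by rintro rfl; simp [hu1] at hs
    have hp0 : (u - 1) * (u - l) ≠ 0 := by rw [← norm_pos_iff, norm_mul, hu0, hul]; norm_num
    have ht0 : t ≠ 0 := by rintro rfl; rw [ht] at hp0; simp at hp0
    refine ⟨x, u, y * s * t, mul_ne_zero (mul_ne_zero hy hs0) ht0, ?_, ?_, ?_⟩
    · rw [hf]
      linear_combination -y ^ 2 * t ^ 2 * hs - y ^ 2 * u * ht
    · rw [evMap_stdBasis]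
      exact if_pos (.of_isSquare_right ⟨t, ht⟩ hp0)
    · rw [evMap_stdBasis]
      refine if_neg ?_
      change ¬HilbertTrivial (x * (x - β)) (u * (u - l))
      rw [mul_comm u]
      exact hnontriv _ _ hu1 ⟨s, hs⟩ hul hsl

end Normalized

theorem stmt19 (p : ℕ) [Fact p.Prime] (hp : 2 < p) (a b a' b' : ℚ_[p])
    (ha : a ≠ 0) (hb : b ≠ 0) (ha' : a' ≠ 0) (hb' : b' ≠ 0)
    (haZ : 0 ≤ a.valuation) (hbZ : 0 ≤ b.valuation)
    (hab : a ≠ b) (hab' : a' ≠ b')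
    (hunit : a.valuation = 0) (hred : 1 ≤ (a - b).valuation)
    (hunit' : a'.valuation = 0) (hunitb' : b'.valuation = 0)
    (hgood' : (a' - b').valuation = 0)
    (hker : ∀ ε : Fin 4 → ZMod 2, IsKernelVector a b a' b' ε) :
    (∀ x u z : ℚ_[p], z ≠ 0 →
        z ^ 2 = x * (x - a) * (x - b) * (u * (u - a') * (u - b')) →
        evMap a b a' b' (stdBasis 0) x u = 0 ∧
        evMap a b a' b' (stdBasis 1) x u = 0) ∧
    (∀ ε ∈ ({stdBasis 2, stdBasis 3, stdBasis 2 + stdBasis 3} : Set (Fin 4 → ZMod 2)),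
      ∃ x₁ u₁ z₁ x₂ u₂ z₂ : ℚ_[p],
        z₁ ≠ 0 ∧ z₁ ^ 2 = x₁ * (x₁ - a) * (x₁ - b) * (u₁ * (u₁ - a') * (u₁ - b')) ∧
        z₂ ≠ 0 ∧ z₂ ^ 2 = x₂ * (x₂ - a) * (x₂ - b) * (u₂ * (u₂ - a') * (u₂ - b')) ∧
        evMap a b a' b' ε x₁ u₁ ≠ evMap a b a' b' ε x₂ u₂) := by
  have hnorm : ∀ x : ℚ_[p], x ≠ 0 → x.valuation = 0 → ‖x‖ = 1 := fun x hx h => by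
    rw [Padic.norm_eq_zpow_neg_valuation hx, h, neg_zero, zpow_zero]
  have ha1 := hnorm a ha hunit
  have ha1' := hnorm a' ha' hunit'
  have hsq := isSquare_SZMatrix hker
  have h01 : IsSquare (a * b) := hsq 0 1
  have h02 : IsSquare (a' * b') := hsq 0 2
  have h03 : IsSquare (-(a * a')) := hsq 0 3
  have h12 : IsSquare (a * a') := hsq 1 2
  have h13 : IsSquare (a' * (a' - b')) := hsq 1 3
  have h23 : IsSquare (a * (a - b)) := hsq 2 3
  have hneg : IsSquare (-1 : ℚ_[p]) := by
    have := h03.div h12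
    rwa [neg_div, div_self (mul_ne_zero ha ha')] at this
  obtain ⟨β, rfl⟩ : ∃ β, b = a * β := ⟨b / a, by field_simp⟩
  obtain ⟨l, rfl⟩ : ∃ l, b' = a' * l := ⟨b' / a', by field_simp⟩
  have hcancel : ∀ c d : ℚ_[p], c ≠ 0 → IsSquare (c * (c * d)) → IsSquare d := fun c d hc h => by
    have := h.div (IsSquare.sq c)
    rwa [show c * (c * d) / c ^ 2 = d by field_simp] at this
  rw [show a - a * β = a * (1 - β) by ring] at h23 hred
  rw [show a' - a' * l = a' * (1 - l) by ring] at h13 hgood'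
  have hβ1 : β ≠ 1 := fun h => hab (by rw [h, mul_one])
  have hl1 : l ≠ 1 := fun h => hab' (by rw [h, mul_one])
  have hβs := hcancel _ _ ha h23
  have hls := hcancel _ _ ha' h02
  have hls' := hcancel _ _ ha' h13
  have hl : ‖l‖ = 1 := by
    simpa [ha1'] using hnorm _ hb' hunitb'
  have hl' : ‖1 - l‖ = 1 := by
    have := hnorm _ (mul_ne_zero ha' (sub_ne_zero.2 hl1.symm)) hgood'
    rwa [norm_mul, ha1', one_mul] at this
  have hβ : ‖1 - β‖ < 1 := by
    have h0 := mul_ne_zero ha (sub_ne_zero.2 hβ1.symm)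
    have : ‖a * (1 - β)‖ < 1 := by
      rw [Padic.norm_eq_zpow_neg_valuation h0]
      exact zpow_lt_one_of_neg₀ (by exact_mod_cast (Fact.out : p.Prime).one_lt) (by omega)
    rwa [norm_mul, ha1, one_mul] at this
  obtain ⟨w, hw⟩ := h12
  have hw0 : w ≠ 0 := by
    rintro rfl
    simp [ha, ha'] at hw
  constructor
  · intro x u z hz hsurf
    obtain ⟨x, rfl⟩ : ∃ y, x = a * y := ⟨x / a, by field_simp⟩
    obtain ⟨u, rfl⟩ : ∃ y, u = a' * y := ⟨u / a', by field_simp⟩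
    rw [evMap_mul ha ha', evMap_mul ha ha']
    refine evMap_normalized_eq_zero hp hneg hβ hl hl' hls hls' (z := z / w ^ 3)
      (div_ne_zero hz (pow_ne_zero 3 hw0)) ?_
    rw [div_pow, hsurf, div_eq_iff (by positivity), ← pow_mul,
      show w ^ (3 * 2) = (w * w) ^ 3 by ring, ← hw]
    ring
  · have hlift : ∀ x u z : ℚ_[p], z ≠ 0 →
        z ^ 2 = x * (x - 1) * (x - β) * (u * (u - 1) * (u - l)) →
        w ^ 3 * z ≠ 0 ∧ (w ^ 3 * z) ^ 2 = a * x * (a * x - a) * (a * x - a * β) *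
          (a' * u * (a' * u - a') * (a' * u - a' * l)) := fun x u z hz h => by
      refine ⟨mul_ne_zero (pow_ne_zero 3 hw0) hz, ?_⟩
      rw [mul_pow, h, ← pow_mul, show w ^ (3 * 2) = (w * w) ^ 3 by ring, ← hw]
      ring
    have hsep : ∀ (ε : Fin 4 → ZMod 2) (x u z x' u' z' : ℚ_[p]), z ≠ 0 →
        z ^ 2 = x * (x - 1) * (x - β) * (u * (u - 1) * (u - l)) → z' ≠ 0 →
        z' ^ 2 = x' * (x' - 1) * (x' - β) * (u' * (u' - 1) * (u' - l)) →
        evMap 1 β 1 l ε x u = 0 → evMap 1 β 1 l ε x' u' = 1 →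
        ∃ x₁ u₁ z₁ x₂ u₂ z₂ : ℚ_[p],
          z₁ ≠ 0 ∧ z₁ ^ 2 = x₁ * (x₁ - a) * (x₁ - a * β) * (u₁ * (u₁ - a') * (u₁ - a' * l)) ∧
          z₂ ≠ 0 ∧ z₂ ^ 2 = x₂ * (x₂ - a) * (x₂ - a * β) * (u₂ * (u₂ - a') * (u₂ - a' * l)) ∧
          evMap a (a * β) a' (a' * l) ε x₁ u₁ ≠ evMap a (a * β) a' (a' * l) ε x₂ u₂ := by
      intro ε x u z x' u' z' hz h hz' h' h0 h1
      refine ⟨a * x, a' * u, w ^ 3 * z, a * x', a' * u', w ^ 3 * z', (hlift x u z hz h).1,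
        (hlift x u z hz h).2, (hlift x' u' z' hz' h').1, (hlift x' u' z' hz' h').2, ?_⟩
      rw [evMap_mul ha ha', evMap_mul ha ha', h0, h1]
      exact zero_ne_one
    obtain ⟨x, u, z, hz, h, h2, h3⟩ := exists_evMap_normalized_eq_zero hp hβ hl
    obtain ⟨⟨x', u', z', hz', h', h2', h3'⟩, x'', u'', z'', hz'', h'', -, h3''⟩ :=
      exists_evMap_normalized_eq_one hp hneg hβ hβ1 hβs hl hl' hls hls'
    rintro ε (rfl | rfl | rfl)
    · exact hsep _ x u z x' u' z' hz h hz' h' h2 h2'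
    · exact hsep _ x u z x'' u'' z'' hz h hz'' h'' h3 h3''
    · exact hsep _ x u z x' u' z' hz h hz' h' (by rw [evMap_stdBasis_add, h2, h3, add_zero])
        (by rw [evMap_stdBasis_add, h2', h3', add_zero])
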